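/- arXiv:2109.07795 — 3 statements merged into one kernel-verified Lean document; each statement's English description precedes it below -/
import Mathlib

section
/- Let M, N be weight sequences satisfying m_k^{1/k}→∞ and n_k^{1/k}→∞, and suppose C := mg(M,N) < ∞. Then h_m(t) ≤ C^j · n_j · t^j · h_n(Ct) for all t>0 and all j ∈ ℕ. -/
open Set Filter Topology Metric
open scoped ENNReal NNReal Topology

noncomputable section

namespace JorisPaper

/-- The sequence `m` with `m_k = M_k / k!`. -/
def lc (M : ℕ → ℝ) (k : ℕ) : ℝ := M k / (Nat.factorial k : ℝ)

/-- A weight sequence: positive, log-convex, `M_0 = 1 ≤ M_1`, `M_k^{1/k} → ∞`. -/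
structure IsWeightSeq (M : ℕ → ℝ) : Prop where
  pos : ∀ k, 0 < M k
  first : M 0 = 1
  one_le : 1 ≤ M 1
  logconvex : ∀ k, 1 ≤ k → M k ^ 2 ≤ M (k - 1) * M (k + 1)
  root : Filter.Tendsto (fun k : ℕ => M k ^ ((1 : ℝ) / (k : ℝ))) atTop atTop

/-- `m_k^{1/k} → ∞`. -/
def RootsTendsto (m : ℕ → ℝ) : Prop :=
  Filter.Tendsto (fun k : ℕ => m k ^ ((1 : ℝ) / (k : ℝ))) atTop atTop

/-- `h_m(t) = inf_k m_k t^k` for `t > 0`, and `0` for `t ≤ 0`. -/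
def hfn (m : ℕ → ℝ) (t : ℝ) : ℝ := if t ≤ 0 then 0 else ⨅ k : ℕ, m k * t ^ k

/-- `Γ̄_m(t) = min {k | h_m(t) = m_k t^k}`. -/
def GammaUpper (m : ℕ → ℝ) (t : ℝ) : ℕ := sInf {k : ℕ | hfn m t = m k * t ^ k}

/-- `Γ̲_m(t) = min {k | m_{k+1}/m_k ≥ 1/t}`. -/
def GammaLower (m : ℕ → ℝ) (t : ℝ) : ℕ := sInf {k : ℕ | 1 / t ≤ m (k + 1) / m k}

/-- `mg(M,N) = sup_{j+k ≥ 1} (M_{j+k}/(N_j N_k))^{1/(j+k)}`, as an extended real. -/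
def mg (M N : ℕ → ℝ) : ℝ≥0∞ :=
  ⨆ (j : ℕ) (k : ℕ) (_ : 1 ≤ j + k),
    ENNReal.ofReal ((M (j + k) / (N j * N k)) ^ (((j : ℝ) + (k : ℝ))⁻¹))

/-- A weight matrix: a totally ordered (pointwise) family of weight sequences. -/
structure IsWeightMatrix (W : Set (ℕ → ℝ)) : Prop where
  weight : ∀ M ∈ W, IsWeightSeq M
  ordered : ∀ M ∈ W, ∀ N ∈ W, (∀ k, M k ≤ N k) ∨ (∀ k, N k ≤ M k)

/-- R-admissible weight matrix. -/
structure RAdmissible (W : Set (ℕ → ℝ)) : Prop where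
  matrix : IsWeightMatrix W
  roots : ∀ M ∈ W, RootsTendsto (lc M)
  gamma : ∀ M ∈ W, ∃ N ∈ W, ∃ C : ℝ, 1 ≤ C ∧
    ∀ t : ℝ, 0 < t → GammaUpper (lc N) (C * t) ≤ GammaLower (lc M) t
  mgrowth : ∀ M ∈ W, ∃ N ∈ W, mg M N < ⊤

/-- B-admissible weight matrix. -/
structure BAdmissible (W : Set (ℕ → ℝ)) : Prop where
  matrix : IsWeightMatrix W
  roots : ∀ M ∈ W, RootsTendsto (lc M)
  gamma : ∀ M ∈ W, ∃ N ∈ W, ∃ C : ℝ, 1 ≤ C ∧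
    ∀ t : ℝ, 0 < t → GammaUpper (lc M) (C * t) ≤ GammaLower (lc N) t
  mgrowth : ∀ M ∈ W, ∃ N ∈ W, mg N M < ⊤

/-- `‖f‖^M_{K,ρ} < ∞` (derivatives taken within `U`). -/
def SeqBoundedOn {E F : Type*} [NormedAddCommGroup E] [NormedSpace ℝ E]
    [NormedAddCommGroup F] [NormedSpace ℝ F]
    (M : ℕ → ℝ) (ρ : ℝ) (f : E → F) (U K : Set E) : Prop :=
  ∃ C : ℝ, ∀ x ∈ K, ∀ k : ℕ, ‖iteratedFDerivWithin ℝ k f U x‖ ≤ C * ρ ^ k * M k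

/-- `f ∈ B^M_ρ(V)`: smooth on `V` with global bounds `‖f‖^M_{V,ρ} < ∞`. -/
def GlobalClass {E F : Type*} [NormedAddCommGroup E] [NormedSpace ℝ E]
    [NormedAddCommGroup F] [NormedSpace ℝ F]
    (M : ℕ → ℝ) (ρ : ℝ) (f : E → F) (V : Set E) : Prop :=
  ContDiffOn ℝ (⊤ : ℕ∞) f V ∧ SeqBoundedOn M ρ f V V

/-- The Roumieu class `E^{{W}}(U)`. -/
def Roumieu {E F : Type*} [NormedAddCommGroup E] [NormedSpace ℝ E]
    [NormedAddCommGroup F] [NormedSpace ℝ F]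
    (W : Set (ℕ → ℝ)) (U : Set E) (f : E → F) : Prop :=
  ContDiffOn ℝ (⊤ : ℕ∞) f U ∧
    ∀ K ⊆ U, IsCompact K → ∃ M ∈ W, ∃ ρ : ℝ, 0 < ρ ∧ SeqBoundedOn M ρ f U K

/-- The Beurling class `E^{(W)}(U)`. -/
def Beurling {E F : Type*} [NormedAddCommGroup E] [NormedSpace ℝ E]
    [NormedAddCommGroup F] [NormedSpace ℝ F]
    (W : Set (ℕ → ℝ)) (U : Set E) (f : E → F) : Prop :=
  ContDiffOn ℝ (⊤ : ℕ∞) f U ∧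
    ∀ K ⊆ U, IsCompact K → ∀ M ∈ W, ∀ ρ : ℝ, 0 < ρ → SeqBoundedOn M ρ f U K

/-- The open ellipse `Ω_ε` with vertices `±cosh ε` and co-vertices `±i sinh ε`. -/
def Omega (ε : ℝ) : Set ℂ :=
  {z : ℂ | (z.re / Real.cosh ε) ^ 2 + (z.im / Real.sinh ε) ^ 2 < 1}

/-- `V_U = ⋃_{x ∈ U} (x + 𝔹)`. -/
def VU {E : Type*} [NormedAddCommGroup E] [NormedSpace ℝ E] (U : Set E) : Set E :=
  ⋃ x ∈ U, Metric.closedBall x 1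

/-- A weight function in the sense of Braun–Meise–Taylor. -/
structure IsWeightFunction (ω : ℝ → ℝ) : Prop where
  cont : ContinuousOn ω (Ici 0)
  mono : MonotoneOn ω (Ici 0)
  nonneg : ∀ t, 0 ≤ t → 0 ≤ ω t
  bigO : (fun t => ω (2 * t)) =O[atTop] ω
  littleO : ω =o[atTop] (fun t => t)
  logLittleO : Real.log =o[atTop] ω
  convex : ConvexOn ℝ (Ici 0) (fun t => ω (Real.exp t))

/-- The Young conjugate `φ*_ω(s) = sup_{t ≥ 0} (s t - ω(e^t))`. -/
def youngConj (ω : ℝ → ℝ) (s : ℝ) : ℝ :=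
  sSup {y : ℝ | ∃ t : ℝ, 0 ≤ t ∧ y = s * t - ω (Real.exp t)}

/-- The Roumieu class `E^{{ω}}(U)` for a weight function `ω`. -/
def RoumieuW {E F : Type*} [NormedAddCommGroup E] [NormedSpace ℝ E]
    [NormedAddCommGroup F] [NormedSpace ℝ F]
    (ω : ℝ → ℝ) (U : Set E) (f : E → F) : Prop :=
  ContDiffOn ℝ (⊤ : ℕ∞) f U ∧
    ∀ K ⊆ U, IsCompact K → ∃ C : ℝ, 0 < C ∧ ∃ ρ : ℝ, 0 < ρ ∧
      ∀ x ∈ K, ∀ k : ℕ, ‖iteratedFDerivWithin ℝ k f U x‖ ≤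
        C * Real.exp ((1 / ρ) * youngConj ω (ρ * k))

/-- The Beurling class `E^{(ω)}(U)` for a weight function `ω`. -/
def BeurlingW {E F : Type*} [NormedAddCommGroup E] [NormedSpace ℝ E]
    [NormedAddCommGroup F] [NormedSpace ℝ F]
    (ω : ℝ → ℝ) (U : Set E) (f : E → F) : Prop :=
  ContDiffOn ℝ (⊤ : ℕ∞) f U ∧
    ∀ K ⊆ U, IsCompact K → ∀ ρ : ℝ, 0 < ρ → ∃ C : ℝ, 0 < C ∧
      ∀ x ∈ K, ∀ k : ℕ, ‖iteratedFDerivWithin ℝ k f U x‖ ≤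
        C * Real.exp ((1 / ρ) * youngConj ω (ρ * k))

/-- Moderate growth: `M_{j+k} ≤ C^{j+k} N_j N_k` with `C = mg(M,N)`. -/
theorem le_mg_pow_mul {M N : ℕ → ℝ} (hM : IsWeightSeq M) (hN : IsWeightSeq N)
    (hmg : mg M N < ⊤) (j k : ℕ) :
    M (j + k) ≤ (mg M N).toReal ^ (j + k) * (N j * N k) := by
  have hNN : 0 < N j * N k := mul_pos (hN.pos j) (hN.pos k)
  rcases Nat.eq_zero_or_pos (j + k) with h | h
  · obtain ⟨rfl, rfl⟩ : j = 0 ∧ k = 0 := by omega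
    simp [hM.first, hN.first]
  · have hq : 0 ≤ M (j + k) / (N j * N k) := (div_pos (hM.pos _) hNN).le
    have hroot : (M (j + k) / (N j * N k)) ^ (((j : ℝ) + (k : ℝ))⁻¹) ≤ (mg M N).toReal := by
      rw [← ENNReal.ofReal_le_iff_le_toReal hmg.ne]
      exact le_iSup_of_le j (le_iSup_of_le k (le_iSup_of_le h le_rfl))
    have hpow := pow_le_pow_left₀ (Real.rpow_nonneg hq _) hroot (j + k)
    rw [← Nat.cast_add, Real.rpow_inv_natCast_pow hq h.ne'] at hpow
    exact (div_le_iff₀ hNN).1 hpow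

theorem mg_toReal_pos {M N : ℕ → ℝ} (hM : IsWeightSeq M) (hN : IsWeightSeq N)
    (hmg : mg M N < ⊤) : 0 < (mg M N).toReal := by
  refine ENNReal.toReal_nonneg.lt_of_ne' fun h => ?_
  have h1 := le_mg_pow_mul hM hN hmg 0 1
  have h2 := hM.pos 1
  simp only [h, zero_add, pow_one, zero_mul] at h1
  linarith

theorem IsWeightSeq.lc_pos {M : ℕ → ℝ} (hM : IsWeightSeq M) (k : ℕ) : 0 < lc M k :=
  div_pos (hM.pos k) (Nat.cast_pos.2 k.factorial_pos)

/-- The moderate growth estimate passes to the sequences `m`, `n`. -/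
theorem lc_le_mg_pow_mul {M N : ℕ → ℝ} (hM : IsWeightSeq M) (hN : IsWeightSeq N)
    (hmg : mg M N < ⊤) (j k : ℕ) :
    lc M (j + k) ≤ (mg M N).toReal ^ (j + k) * (lc N j * lc N k) := by
  have hfac : (j.factorial : ℝ) * k.factorial ≤ (j + k).factorial := by
    exact_mod_cast Nat.le_of_dvd (Nat.factorial_pos _)
      (Nat.factorial_mul_factorial_dvd_factorial_add j k)
  calc lc M (j + k) ≤ M (j + k) / (j.factorial * k.factorial) :=
        div_le_div_of_nonneg_left (hM.pos _).le (by positivity) hfac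
    _ ≤ (mg M N).toReal ^ (j + k) * (N j * N k) / (j.factorial * k.factorial) := by
        gcongr
        exact le_mg_pow_mul hM hN hmg j k
    _ = _ := by
        simp only [lc]
        field_simp

/-- `h_m(t) ≤ C^j n_j t^j h_n(Ct)` where `C = mg(M,N) < ∞`. -/
theorem statement6 (M N : ℕ → ℝ) (hM : IsWeightSeq M) (hN : IsWeightSeq N)
    (hm : RootsTendsto (lc M)) (hn : RootsTendsto (lc N))
    (hmg : mg M N < ⊤) :
    ∀ t : ℝ, 0 < t → ∀ j : ℕ,
      hfn (lc M) t ≤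
        (mg M N).toReal ^ j * lc N j * t ^ j * hfn (lc N) ((mg M N).toReal * t) := by
  intro t ht j
  have hC := mg_toReal_pos hM hN hmg
  have hA : 0 ≤ (mg M N).toReal ^ j * lc N j * t ^ j := by
    have := hN.lc_pos j
    positivity
  have hbdd : BddBelow (range fun k : ℕ => lc M k * t ^ k) :=
    ⟨0, by
      rintro _ ⟨k, rfl⟩
      exact mul_nonneg (hM.lc_pos k).le (pow_nonneg ht.le k)⟩
  rw [hfn, hfn, if_neg ht.not_ge, if_neg (mul_pos hC ht).not_ge, Real.mul_iInf_of_nonneg hA]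
  refine le_ciInf fun k => (ciInf_le hbdd (j + k)).trans ?_
  calc lc M (j + k) * t ^ (j + k)
      ≤ (mg M N).toReal ^ (j + k) * (lc N j * lc N k) * t ^ (j + k) := by
        gcongr
        exact lc_le_mg_pow_mul hM hN hmg j k
    _ = _ := by ring

end JorisPaper
end
end

section
/- Let U ⊆ ℝ^d be open, V_U := ⋃_{x∈U}(x+𝔹), and let f : V_U → ℂ be smooth. Let N^{(1)}, N^{(2)}, N^{(3)} be weight sequences with (n^{(i)}_k)^{1/k}→∞ for i=1,2,3 and D^{(i)} := mg(N^{(i)},N^{(i+1)}) < ∞ for i=1,2. Assume that there exist constants K≥1, c_1, c_2>0 and 0<ε_0≤1/2, independent of λ and ε, and for each λ ∈ Λ_U and each 0<ε≤2ε_0 a function f_{λ,ε} holomorphic on Ω_ε and continuous on the closure of Ω_ε, such that sup_{Ω_ε}|f_{λ,ε}| ≤ K and sup_{t∈[-1,1]}|f_λ(t) − f_{λ,ε}(t)| ≤ c_1·h_{n^{(1)}}(c_2·ε). Then there exists σ > 0 (one may take σ = 4e²D^{(1)}D^{(2)}c_2/a for an absolute constant a>0) such that f|_U ∈ B^{N^{(3)}}_σ(U).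 -/
open Set Filter Topology Metric
open scoped ENNReal NNReal Topology

noncomputable section

namespace JorisPaper

section Symmetry

variable {E G : Type*} [NormedAddCommGroup E] [NormedSpace ℝ E]
  [NormedAddCommGroup G] [NormedSpace ℝ G]

theorem contDiffAt_iteratedFDeriv {s : Set E} (hs : IsOpen s) {f : E → G}
    (hf : ContDiffOn ℝ (⊤ : ℕ∞) f s) {x : E} (hx : x ∈ s) (n : ℕ) :
    ContDiffAt ℝ (⊤ : ℕ∞) (iteratedFDeriv ℝ n f) x :=
  (hf.contDiffAt (hs.mem_nhds hx)).iteratedFDeriv_right (by exact_mod_cast le_top)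

theorem fderiv_iteratedFDeriv_apply {s : Set E} (hs : IsOpen s) {f : E → G}
    (hf : ContDiffOn ℝ (⊤ : ℕ∞) f s) {x : E} (hx : x ∈ s) (n : ℕ) (w : Fin n → E) (u : E) :
    fderiv ℝ (iteratedFDeriv ℝ n f) x u w = fderiv ℝ (fun y => iteratedFDeriv ℝ n f y w) x u := by
  have h : DifferentiableAt ℝ (iteratedFDeriv ℝ n f) x :=
    (contDiffAt_iteratedFDeriv hs hf hx n).differentiableAt (by simp)
  have := ((ContinuousMultilinearMap.apply ℝ (fun _ : Fin n => E) G w).hasFDerivAt.comp x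
    h.hasFDerivAt).fderiv
  have h2 : (fun y => iteratedFDeriv ℝ n f y w) =
    (ContinuousMultilinearMap.apply ℝ (fun _ : Fin n => E) G w) ∘ iteratedFDeriv ℝ n f := rfl
  rw [h2, this]; rfl

/-- An iterated derivative of a smooth function is invariant under adjacent transpositions. -/
theorem iteratedFDeriv_comp_adjacent_swap {s : Set E} (hs : IsOpen s) {f : E → G}
    (hf : ContDiffOn ℝ (⊤ : ℕ∞) f s) (n : ℕ) (i : Fin n) :
    ∀ x ∈ s, ∀ v : Fin (n + 1) → E,
      iteratedFDeriv ℝ (n + 1) f x (v ∘ Equiv.swap i.castSucc i.succ)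
        = iteratedFDeriv ℝ (n + 1) f x v := by
  induction n with
  | zero => exact i.elim0
  | succ n ih =>
    intro x hx v
    refine Fin.cases ?_ (fun j => ?_) i
    · have hsymm : IsSymmSndFDerivAt ℝ (iteratedFDeriv ℝ n f) x :=
        (contDiffAt_iteratedFDeriv hs hf hx n).isSymmSndFDerivAt
          (by
            rw [minSmoothness_of_isRCLikeNormedField]
            exact WithTop.coe_le_coe.2 (le_top : (2 : ℕ∞) ≤ ⊤))
      have key : ∀ w : Fin (n + 2) → E, iteratedFDeriv ℝ (n + 2) f x w =
          fderiv ℝ (fderiv ℝ (iteratedFDeriv ℝ n f)) x (w 0) (w 1) (fun k => w k.succ.succ) := by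
        intro w
        rw [iteratedFDeriv_succ_apply_left, fderiv_iteratedFDeriv_apply hs hf hx]
        have hd : DifferentiableAt ℝ (fderiv ℝ (iteratedFDeriv ℝ n f)) x :=
          ((contDiffAt_iteratedFDeriv hs hf hx n).fderiv_right
            (m := (⊤ : ℕ∞)) (by simp)).differentiableAt (by simp)
        have h2 : (fun y => iteratedFDeriv ℝ (n + 1) f y (Fin.tail w)) = fun y =>
            (ContinuousMultilinearMap.apply ℝ (fun _ : Fin n => E) G fun k => w k.succ.succ)
              (fderiv ℝ (iteratedFDeriv ℝ n f) y (w 1)) := by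
          funext y
          rw [iteratedFDeriv_succ_apply_left]; rfl
        rw [h2]
        have h3 := ((ContinuousMultilinearMap.apply ℝ (fun _ : Fin n => E) G
          fun k => w k.succ.succ).hasFDerivAt.comp x
            (hd.hasFDerivAt.clm_apply (hasFDerivAt_const (w 1) x))).fderiv
        have h4 := congrArg (fun L => L (w 0)) h3
        simpa [Function.comp_def] using h4
      rw [key, key]
      have e0 : (v ∘ Equiv.swap (Fin.castSucc (0 : Fin (n + 1))) (Fin.succ 0)) 0 = v 1 := by simp
      have e1 : (v ∘ Equiv.swap (Fin.castSucc (0 : Fin (n + 1))) (Fin.succ 0)) 1 = v 0 := by simp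
      have e2 : (fun k : Fin n => (v ∘ Equiv.swap (Fin.castSucc (0 : Fin (n + 1))) (Fin.succ 0))
          k.succ.succ) = fun k => v k.succ.succ := by
        funext k
        simp only [Function.comp_apply]
        rw [Equiv.swap_apply_of_ne_of_ne]
        · simp [Fin.ext_iff]
        · simp [Fin.ext_iff]
      rw [e0, e1, e2, hsymm.eq]
    · rw [iteratedFDeriv_succ_apply_left, iteratedFDeriv_succ_apply_left,
        fderiv_iteratedFDeriv_apply hs hf hx, fderiv_iteratedFDeriv_apply hs hf hx]
      have e0 : (v ∘ Equiv.swap j.succ.castSucc j.succ.succ) 0 = v 0 := by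
        simp only [Function.comp_apply]
        rw [Equiv.swap_apply_of_ne_of_ne]
        · simp [Fin.ext_iff]
        · simp [Fin.ext_iff]
      have e1 : Fin.tail (v ∘ Equiv.swap j.succ.castSucc j.succ.succ)
          = Fin.tail v ∘ Equiv.swap j.castSucc j.succ := by
        funext k
        simp only [Fin.tail, Function.comp_apply]
        congr 1
        rw [← Fin.succ_castSucc]
        exact ((Fin.succ_injective _).swap_apply _ _ _)
      rw [e0, e1]
      congr 1
      apply Filter.EventuallyEq.fderiv_eq
      filter_upwards [hs.mem_nhds hx] with y hy
      exact ih j y hy (Fin.tail v)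

/-- Iterated derivatives of a smooth function are symmetric. -/
theorem iteratedFDeriv_comp_perm_of_contDiffOn {s : Set E} (hs : IsOpen s) {f : E → G}
    (hf : ContDiffOn ℝ (⊤ : ℕ∞) f s) {x : E} (hx : x ∈ s) {n : ℕ} (σ : Equiv.Perm (Fin n))
    (v : Fin n → E) :
    iteratedFDeriv ℝ n f x (v ∘ σ) = iteratedFDeriv ℝ n f x v := by
  cases n with
  | zero => congr 1; exact Subsingleton.elim _ _
  | succ n =>
    have hσ : σ ∈ Submonoid.closure
        (Set.range fun i : Fin n => Equiv.swap i.castSucc i.succ) := by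
      rw [Equiv.Perm.mclosure_swap_castSucc_succ]; trivial
    induction hσ using Submonoid.closure_induction generalizing v with
    | mem τ hτ =>
      obtain ⟨i, rfl⟩ := hτ
      exact iteratedFDeriv_comp_adjacent_swap hs hf n i x hx v
    | one => rfl
    | mul a b _ _ ha hb => rw [Equiv.Perm.coe_mul, ← Function.comp_assoc, hb, ha]

end Symmetry

section Polarization

/-- Orthogonality of the sign characters underlying the polarization identity. -/
theorem sum_signs_eq_zero {k : ℕ} {r : Fin k → Fin k} (hr : ¬ Function.Surjective r) :
    ∑ s : Fin k → ℤˣ, ((∏ i, ((s i : ℤ) : ℝ)) * ∏ i, ((s (r i) : ℤ) : ℝ)) = 0 := by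
  simp only [Function.Surjective, not_forall, not_exists] at hr
  obtain ⟨j, hj⟩ := hr
  set S := ∑ s : Fin k → ℤˣ, ((∏ i, ((s i : ℤ) : ℝ)) * ∏ i, ((s (r i) : ℤ) : ℝ)) with hS
  have hinv : Function.Involutive (fun s : Fin k → ℤˣ => Function.update s j (-s j)) := by
    intro s; simp
  have h : S = -S := by
    conv_lhs => rw [hS, ← Equiv.sum_comp hinv.toPerm]
    rw [hS, ← Finset.sum_neg_distrib]
    refine Finset.sum_congr rfl fun s _ => ?_
    have h1 : ∀ i, Function.update s j (-s j) (r i) = s (r i) := fun i => by simp [hj i]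
    have h2 : ∏ i, ((Function.update s j (-s j) i : ℤ) : ℝ) = -∏ i, ((s i : ℤ) : ℝ) := by
      rw [← Finset.mul_prod_erase _ _ (Finset.mem_univ j),
        ← Finset.mul_prod_erase _ (fun i => ((s i : ℤ) : ℝ)) (Finset.mem_univ j)]
      have : ∏ i ∈ Finset.univ.erase j, ((Function.update s j (-s j) i : ℤ) : ℝ)
          = ∏ i ∈ Finset.univ.erase j, ((s i : ℤ) : ℝ) :=
        Finset.prod_congr rfl fun i hi => by simp [Finset.ne_of_mem_erase hi]
      rw [this]; simp
    simp only [Function.Involutive.coe_toPerm, h1, h2]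
    ring
  linarith

variable {E G : Type*} [NormedAddCommGroup E] [NormedSpace ℝ E]
  [NormedAddCommGroup G] [NormedSpace ℝ G]

/-- The polarization identity for symmetric multilinear maps. -/
theorem polarization_identity {k : ℕ} (A : ContinuousMultilinearMap ℝ (fun _ : Fin k => E) G)
    (hA : ∀ (σ : Equiv.Perm (Fin k)) (v : Fin k → E), A (v ∘ σ) = A v) (v : Fin k → E) :
    ∑ s : Fin k → ℤˣ, (∏ i, ((s i : ℤ) : ℝ)) • A (fun _ => ∑ j, ((s j : ℤ) : ℝ) • v j)
      = ((2 : ℝ) ^ k * k.factorial) • A v := by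
  classical
  simp only [A.map_sum, A.map_smul_univ, Finset.smul_sum, smul_smul]
  rw [Finset.sum_comm]
  simp only [← Finset.sum_smul]
  rw [← Finset.sum_subset (Finset.subset_univ
    (Finset.univ.filter fun r : Fin k → Fin k => Function.Bijective r))]
  · have h1 : ∀ r ∈ Finset.univ.filter (fun r : Fin k → Fin k => Function.Bijective r),
        (∑ s : Fin k → ℤˣ, ((∏ i, ((s i : ℤ) : ℝ)) * ∏ i, ((s (r i) : ℤ) : ℝ)))
          • A (fun i => v (r i)) = (2 : ℝ) ^ k • A v := by
      intro r hr
      have hb : Function.Bijective r := (Finset.mem_filter.1 hr).2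
      have h2 : A (fun i => v (r i)) = A v := hA (Equiv.ofBijective r hb) v
      rw [h2]
      congr 1
      have h3 : ∀ s : Fin k → ℤˣ,
          ((∏ i, ((s i : ℤ) : ℝ)) * ∏ i, ((s (r i) : ℤ) : ℝ)) = 1 := by
        intro s
        have : ∏ i, ((s (r i) : ℤ) : ℝ) = ∏ i, ((s i : ℤ) : ℝ) :=
          Equiv.prod_comp (Equiv.ofBijective r hb) fun i => ((s i : ℤ) : ℝ)
        rw [this, ← Finset.prod_mul_distrib]
        refine Finset.prod_eq_one fun i _ => ?_
        rcases Int.units_eq_one_or (s i) with h | h <;> simp [h]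
      simp [h3]
    rw [Finset.sum_congr rfl h1, Finset.sum_const, ← Nat.cast_smul_eq_nsmul ℝ, smul_smul]
    congr 1
    have : (Finset.univ.filter fun r : Fin k → Fin k => Function.Bijective r).card
        = k.factorial := by
      rw [← Fintype.card_subtype, ← Fintype.card_of_bijective
        (f := fun σ : Equiv.Perm (Fin k) => (⟨σ, σ.bijective⟩ :
          {r : Fin k → Fin k // Function.Bijective r}))
        ⟨fun _ _ h => DFunLike.coe_injective (congrArg Subtype.val h),
          fun r => ⟨Equiv.ofBijective r.1 r.2, rfl⟩⟩]
      simp [Fintype.card_perm]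
    rw [this, mul_comm]
  · intro r _ hr
    have : ¬ Function.Surjective r := fun h => hr (by
      simpa using Finite.surjective_iff_bijective.1 h)
    rw [sum_signs_eq_zero this, zero_smul]

/-- A symmetric multilinear map is controlled by its values on the diagonal. -/
theorem norm_le_exp_mul_of_diagonal {k : ℕ}
    (A : ContinuousMultilinearMap ℝ (fun _ : Fin k => E) G)
    (hA : ∀ (σ : Equiv.Perm (Fin k)) (v : Fin k → E), A (v ∘ σ) = A v) {B : ℝ} (hB : 0 ≤ B)
    (h : ∀ v : E, ‖v‖ ≤ k → ‖A fun _ => v‖ ≤ B * ‖v‖ ^ k) :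
    ‖A‖ ≤ Real.exp 1 ^ k * B := by
  have hunit : ∀ v : Fin k → E, (∀ i, ‖v i‖ ≤ 1) → ‖A v‖ ≤ Real.exp 1 ^ k * B := by
    intro v hv
    have hsgn : ∀ u : ℤˣ, ‖((u : ℤ) : ℝ)‖ = 1 := fun u => by
      rcases Int.units_eq_one_or u with h | h <;> simp [h]
    have h1 : ‖((2 : ℝ) ^ k * k.factorial) • A v‖ ≤ ∑ _s : Fin k → ℤˣ, B * (k : ℝ) ^ k := by
      rw [← polarization_identity A hA v]
      refine (norm_sum_le _ _).trans (Finset.sum_le_sum fun s _ => ?_)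
      rw [norm_smul, norm_prod]
      simp only [hsgn, Finset.prod_const_one, one_mul]
      have hn : ‖∑ j, ((s j : ℤ) : ℝ) • v j‖ ≤ k := by
        refine (norm_sum_le _ _).trans ?_
        refine (Finset.sum_le_sum (g := fun _ => (1 : ℝ)) fun j _ => ?_).trans (by simp)
        rw [norm_smul, hsgn, one_mul]; exact hv j
      exact (h _ hn).trans (by gcongr)
    have h2 : ((2 : ℝ) ^ k * k.factorial) * ‖A v‖ ≤ 2 ^ k * (B * (k : ℝ) ^ k) := by
      rw [norm_smul] at h1
      simpa [abs_of_nonneg] using h1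
    have h3 : (k.factorial : ℝ) * ‖A v‖ ≤ B * (k : ℝ) ^ k := by
      rw [mul_assoc] at h2
      exact le_of_mul_le_mul_left h2 (by positivity)
    have h4 : (k : ℝ) ^ k / k.factorial ≤ Real.exp 1 ^ k := by
      rw [← Real.exp_nat_mul, mul_one]
      exact Real.pow_div_factorial_le_exp _ (by positivity) k
    have hfac : (0 : ℝ) < k.factorial := by positivity
    rw [div_le_iff₀ hfac] at h4
    have h5 : (k.factorial : ℝ) * ‖A v‖ ≤ k.factorial * (Real.exp 1 ^ k * B) := by
      nlinarith [mul_le_mul_of_nonneg_left h4 hB]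
    exact le_of_mul_le_mul_left h5 hfac
  refine A.opNorm_le_bound (by positivity) fun m => ?_
  by_cases hm : ∃ i, m i = 0
  · obtain ⟨i, hi⟩ := hm
    rw [A.map_coord_zero i hi, norm_zero]; positivity
  · push Not at hm
    have h1 := hunit (fun i => ‖m i‖⁻¹ • m i) fun i => by
      rw [norm_smul, norm_inv, norm_norm, inv_mul_cancel₀ (norm_ne_zero_iff.2 (hm i))]
    have h2 : A m = (∏ i, ‖m i‖) • A (fun i => ‖m i‖⁻¹ • m i) := by
      rw [A.map_smul_univ, smul_smul, ← Finset.prod_mul_distrib,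
        Finset.prod_eq_one fun i _ => mul_inv_cancel₀ (norm_ne_zero_iff.2 (hm i)), one_smul]
    rw [h2, norm_smul, Real.norm_of_nonneg (by positivity), mul_comm]
    gcongr

end Polarization

section TwoConstants

/-- Two-constants estimate on the upper half of the unit disc, with harmonic majorant
`Re (z ^ 2 - 2 * I * z)`. -/
theorem norm_le_sqrt_of_upper_half {G : ℂ → ℂ} {M δ : ℝ} (hδ : 0 < δ) (hδM : δ ≤ M)
    (hG : DifferentiableOn ℂ G (ball 0 1)) (hGc : ContinuousOn G (closedBall 0 1))
    (hM : ∀ z ∈ closedBall (0 : ℂ) 1, ‖G z‖ ≤ M)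
    (hreal : ∀ t : ℝ, t ∈ Icc (-1 : ℝ) 1 → ‖G t‖ ≤ δ)
    {z : ℂ} (hz : ‖z‖ ≤ 1 / 5) (hzim : 0 < z.im) : ‖G z‖ ≤ √(M * δ) := by
  have hM0 : 0 < M := hδ.trans_le hδM
  set L := Real.log (M / δ) with hL
  have hL0 : 0 ≤ L := Real.log_nonneg (by rwa [le_div_iff₀ hδ, one_mul])
  have hexpL : Real.exp L = M / δ := Real.exp_log (by positivity)
  set W : ℂ → ℂ := fun z => -(L : ℂ) * (z ^ 2 - 2 * Complex.I * z) with hW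
  have hWre : ∀ z : ℂ, (W z).re = -L * (z.re ^ 2 - z.im ^ 2 + 2 * z.im) := by
    intro z; simp [hW, pow_two]
  set H : Set ℂ := ball 0 1 ∩ {z | 0 < z.im} with hH
  have hHo : IsOpen H := isOpen_ball.inter (isOpen_lt continuous_const Complex.continuous_im)
  have hcl : closure H ⊆ closedBall 0 1 ∩ {z | 0 ≤ z.im} :=
    closure_minimal (inter_subset_inter ball_subset_closedBall
        fun z hz => show 0 ≤ z.im from le_of_lt hz)
      (isClosed_closedBall.inter (isClosed_le continuous_const Complex.continuous_im))
  have hWd : Differentiable ℂ fun z => Complex.exp (W z) := by fun_prop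
  have hd : DiffContOnCl ℂ (fun z => G z * Complex.exp (W z)) H :=
    ⟨(hG.mono inter_subset_left).mul hWd.differentiableOn,
      (hGc.mono (hcl.trans inter_subset_left)).mul hWd.continuous.continuousOn⟩
  have key : ‖G z * Complex.exp (W z)‖ ≤ δ := by
    refine Complex.norm_le_of_forall_mem_frontier_norm_le (isBounded_ball.subset inter_subset_left)
      hd (fun w hw => ?_) (subset_closure ⟨by rw [mem_ball_zero_iff]; linarith, hzim⟩)
    rw [frontier, hHo.interior_eq] at hw
    obtain ⟨hwb, hwi⟩ := hcl hw.1
    have hwi : 0 ≤ w.im := hwi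
    have hwn : ‖w‖ ≤ 1 := mem_closedBall_zero_iff.1 hwb
    have hsq : w.re ^ 2 + w.im ^ 2 = ‖w‖ ^ 2 := by
      rw [← Complex.normSq_eq_norm_sq, Complex.normSq_apply]; ring
    rw [norm_mul, Complex.norm_exp, hWre]
    rcases eq_or_lt_of_le hwi with h0 | h0
    · have hw' : w = (w.re : ℂ) := Complex.ext rfl (by simp [← h0])
      have h1 : ‖G w‖ ≤ δ := by
        rw [hw']; exact hreal _ (abs_le.1 ((Complex.abs_re_le_norm w).trans hwn))
      have h2 : Real.exp (-L * (w.re ^ 2 - w.im ^ 2 + 2 * w.im)) ≤ 1 := by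
        rw [Real.exp_le_one_iff, ← h0]
        nlinarith [mul_nonneg hL0 (sq_nonneg w.re)]
      exact (mul_le_mul h1 h2 (Real.exp_nonneg _) hδ.le).trans_eq (mul_one δ)
    · have hw1 : ‖w‖ = 1 := by
        by_contra hne
        exact hw.2 ⟨mem_ball_zero_iff.2 (lt_of_le_of_ne hwn hne), h0⟩
      have him1 : w.im ≤ 1 := (le_abs_self _).trans ((Complex.abs_im_le_norm w).trans hwn)
      have h2 : Real.exp (-L * (w.re ^ 2 - w.im ^ 2 + 2 * w.im)) ≤ δ / M := by
        have : δ / M = Real.exp (-L) := by rw [Real.exp_neg, hexpL, inv_div]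
        rw [this, Real.exp_le_exp]
        have : 1 ≤ w.re ^ 2 - w.im ^ 2 + 2 * w.im := by
          rw [hw1] at hsq; nlinarith
        nlinarith
      calc ‖G w‖ * Real.exp (-L * (w.re ^ 2 - w.im ^ 2 + 2 * w.im)) ≤ M * (δ / M) :=
            mul_le_mul (hM w hwb) h2 (Real.exp_nonneg _) hM0.le
        _ = δ := by field_simp
  rw [norm_mul, Complex.norm_exp, hWre] at key
  have hsq : z.re ^ 2 + z.im ^ 2 = ‖z‖ ^ 2 := by
    rw [← Complex.normSq_eq_norm_sq, Complex.normSq_apply]; ring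
  have him : z.im ≤ 1 / 5 := (le_abs_self _).trans ((Complex.abs_im_le_norm z).trans hz)
  have hw2 : z.re ^ 2 - z.im ^ 2 + 2 * z.im ≤ 1 / 2 := by
    nlinarith [norm_nonneg z, sq_nonneg z.im]
  have hge : (√(M / δ))⁻¹ ≤ Real.exp (-L * (z.re ^ 2 - z.im ^ 2 + 2 * z.im)) := by
    have : √(M / δ) = Real.exp (L / 2) := by rw [← hexpL, Real.exp_half]
    rw [this, ← Real.exp_neg, Real.exp_le_exp]
    nlinarith
  have hs : 0 < √(M / δ) := Real.sqrt_pos.2 (by positivity)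
  have h3 : ‖G z‖ * (√(M / δ))⁻¹ ≤ δ :=
    (mul_le_mul_of_nonneg_left hge (norm_nonneg _)).trans key
  rw [← div_eq_mul_inv, div_le_iff₀ hs] at h3
  refine h3.trans_eq ?_
  rw [← Real.sqrt_sq hδ.le, ← Real.sqrt_mul (by positivity), Real.sqrt_sq hδ.le]
  congr 1
  field_simp

/-- Two-constants estimate for a disc centred on the real line. -/
theorem norm_le_sqrt_of_disc {G : ℂ → ℂ} {M δ R : ℝ} (hδ : 0 < δ) (hR : 0 < R) {c : ℝ}
    (hG : DifferentiableOn ℂ G (ball (c : ℂ) R)) (hGc : ContinuousOn G (closedBall (c : ℂ) R))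
    (hM : ∀ z ∈ closedBall (c : ℂ) R, ‖G z‖ ≤ M)
    (hreal : ∀ t : ℝ, |t - c| ≤ R → ‖G t‖ ≤ δ)
    {z : ℂ} (hz : ‖z - c‖ ≤ R / 5) : ‖G z‖ ≤ √(M * δ) := by
  have hzM : ‖G z‖ ≤ M := hM z (by rw [mem_closedBall_iff_norm]; linarith)
  rcases lt_or_ge M δ with h | hδM
  · have hM0 : 0 ≤ M := (norm_nonneg _).trans hzM
    refine hzM.trans (Real.le_sqrt_of_sq_le ?_)
    nlinarith
  have hupper : ∀ σ : ℝ, |σ| = 1 → ∀ w : ℂ, ‖w‖ ≤ 1 / 5 → 0 < w.im →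
      ‖G (c + (σ * R : ℝ) * w)‖ ≤ √(M * δ) := by
    intro σ hσ w hw hwi
    have hn : ∀ w : ℂ, ‖((σ * R : ℝ) : ℂ) * w‖ = R * ‖w‖ := fun w => by
      rw [norm_mul, Complex.norm_real, Real.norm_eq_abs, abs_mul, hσ, one_mul, abs_of_pos hR]
    have hb : MapsTo (fun w : ℂ => (c : ℂ) + (σ * R : ℝ) * w) (ball 0 1) (ball c R) := by
      intro w hw
      rw [mem_ball_zero_iff] at hw
      rw [mem_ball_iff_norm, add_sub_cancel_left, hn]
      nlinarith
    have hcb : MapsTo (fun w : ℂ => (c : ℂ) + (σ * R : ℝ) * w) (closedBall 0 1)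
        (closedBall c R) := by
      intro w hw
      rw [mem_closedBall_zero_iff] at hw
      rw [mem_closedBall_iff_norm, add_sub_cancel_left, hn]
      nlinarith
    refine norm_le_sqrt_of_upper_half (G := fun w => G (c + (σ * R : ℝ) * w)) hδ hδM
      (hG.comp (by fun_prop) hb) (hGc.comp (by fun_prop) hcb) (fun w hw => hM _ (hcb hw))
      (fun t ht => ?_) hw hwi
    have := hreal (c + σ * R * t) (by
      rw [add_sub_cancel_left, abs_mul, abs_mul, hσ, one_mul, abs_of_pos hR]
      nlinarith [abs_le.2 ht])
    simpa using this
  rcases lt_trichotomy z.im 0 with hi | hi | hi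
  · have := hupper (-1) (by simp) (-(z - c) / R) (by
      rw [norm_div, norm_neg, Complex.norm_real, Real.norm_of_nonneg hR.le, div_le_iff₀ hR]
      linarith) (by
      rw [Complex.div_ofReal_im]
      apply div_pos _ hR
      simpa using hi)
    have e : (c : ℂ) + ((-1 * R : ℝ) : ℂ) * (-(z - c) / R) = z := by
      have : (R : ℂ) ≠ 0 := by exact_mod_cast hR.ne'
      push_cast; field_simp; ring
    rwa [e] at this
  · have hz' : z = (z.re : ℂ) := Complex.ext rfl (by simp [hi])
    have h1 : ‖G z‖ ≤ δ := by
      rw [hz']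
      refine hreal _ ?_
      have := Complex.abs_re_le_norm (z - c)
      simp at this
      linarith
    refine h1.trans (Real.le_sqrt_of_sq_le ?_)
    nlinarith
  · have := hupper 1 (by simp) ((z - c) / R) (by
      rw [norm_div, Complex.norm_real, Real.norm_of_nonneg hR.le, div_le_iff₀ hR]
      linarith) (by
      rw [Complex.div_ofReal_im]
      apply div_pos _ hR
      simpa using hi)
    have e : (c : ℂ) + ((1 * R : ℝ) : ℂ) * ((z - c) / R) = z := by
      have : (R : ℂ) ≠ 0 := by exact_mod_cast hR.ne'
      push_cast; field_simp; ring
    rwa [e] at this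

/-- Cauchy estimates combined with the two-constants estimate. -/
theorem norm_iteratedDeriv_le_sqrt {G : ℂ → ℂ} {M δ R : ℝ} (hδ : 0 < δ) (hR : 0 < R) {c : ℝ}
    (hG : DifferentiableOn ℂ G (ball (c : ℂ) R)) (hGc : ContinuousOn G (closedBall (c : ℂ) R))
    (hM : ∀ z ∈ closedBall (c : ℂ) R, ‖G z‖ ≤ M)
    (hreal : ∀ t : ℝ, |t - c| ≤ R → ‖G t‖ ≤ δ) (n : ℕ) :
    ‖iteratedDeriv n G c‖ ≤ n.factorial * √(M * δ) / (R / 5) ^ n := by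
  have hR5 : 0 < R / 5 := by positivity
  refine Complex.norm_iteratedDeriv_le_of_forall_mem_sphere_norm_le n hR5
    (DifferentiableOn.diffContOnCl (hG.mono ?_)) fun z hz => ?_
  · rw [closure_ball _ hR5.ne']
    exact closedBall_subset_ball (by linarith)
  · exact norm_le_sqrt_of_disc hδ hR hG hGc hM hreal (mem_sphere_iff_norm.1 hz).le

end TwoConstants

section Limits

/-- Termwise differentiation of a geometrically converging sequence, to finite order. -/
theorem tendsto_iteratedDeriv_of_geometric {s : Set ℝ} (hs : IsOpen s) {g : ℝ → ℂ}
    {φ : ℕ → ℕ → ℝ → ℂ} {k : ℕ} {C : ℕ → ℝ}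
    (hφ : ∀ i j, ∀ t ∈ s, HasDerivAt (φ i j) (φ (i + 1) j t) t)
    (hC : ∀ i ≤ k, ∀ j, ∀ t ∈ s, dist (φ i j t) (φ i (j + 1) t) ≤ C i * (1 / 2) ^ j)
    (hg : ∀ t ∈ s, Tendsto (fun j => φ 0 j t) atTop (𝓝 (g t))) :
    ∀ i ≤ k, ∀ t ∈ s, Tendsto (fun j => φ i j t) atTop (𝓝 (iteratedDeriv i g t)) := by
  intro i
  induction i with
  | zero => intro _ t ht; simpa using hg t ht
  | succ i ih =>
    intro hi t ht
    have ih' := ih (by omega)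
    have hlim : ∀ u ∈ s, ∃ a, Tendsto (fun j => φ (i + 1) j u) atTop (𝓝 a) := fun u hu =>
      cauchySeq_tendsto_of_complete
        (cauchySeq_of_le_geometric (1 / 2) (C (i + 1)) (by norm_num) fun j => hC _ hi j u hu)
    choose! ψ hψ using hlim
    have hunif : TendstoUniformlyOn (φ (i + 1)) ψ atTop s := by
      rw [Metric.tendstoUniformlyOn_iff]
      intro η hη
      have ht0 : Tendsto (fun n : ℕ => C (i + 1) * (1 / 2 : ℝ) ^ n / (1 - 1 / 2)) atTop (𝓝 0) := by
        have := ((tendsto_pow_atTop_nhds_zero_of_lt_one (by norm_num : (0 : ℝ) ≤ 1 / 2)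
          (by norm_num)).const_mul (C (i + 1))).div_const (1 - 1 / 2 : ℝ)
        simpa using this
      filter_upwards [ht0.eventually (gt_mem_nhds hη)] with n hn u hu
      rw [dist_comm]
      exact (dist_le_of_le_geometric_of_tendsto (1 / 2) (C (i + 1)) (by norm_num)
        (fun j => hC _ hi j u hu) (hψ u hu) n).trans_lt hn
    have hder := hasDerivAt_of_tendstoUniformlyOn hs hunif
      (Eventually.of_forall fun j u hu => hφ i j u hu) ih' ht
    rw [iteratedDeriv_succ, hder.deriv]
    exact hψ t ht

theorem norm_iteratedDeriv_le_of_geometric {s : Set ℝ} (hs : IsOpen s) {g : ℝ → ℂ}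
    {φ : ℕ → ℕ → ℝ → ℂ} {k : ℕ} {C : ℕ → ℝ}
    (hφ : ∀ i j, ∀ t ∈ s, HasDerivAt (φ i j) (φ (i + 1) j t) t)
    (hC : ∀ i ≤ k, ∀ j, ∀ t ∈ s, dist (φ i j t) (φ i (j + 1) t) ≤ C i * (1 / 2) ^ j)
    (hg : ∀ t ∈ s, Tendsto (fun j => φ 0 j t) atTop (𝓝 (g t))) {t : ℝ} (ht : t ∈ s) :
    ‖iteratedDeriv k g t‖ ≤ ‖φ k 0 t‖ + 2 * C k := by
  have h := dist_le_of_le_geometric_of_tendsto₀ (1 / 2) (C k) (by norm_num)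
    (fun j => hC k le_rfl j t ht) (tendsto_iteratedDeriv_of_geometric hs hφ hC hg k le_rfl t ht)
  have h2 := norm_le_norm_add_norm_sub' (iteratedDeriv k g t) (φ k 0 t)
  rw [← dist_eq_norm, dist_comm] at h2
  norm_num at h
  linarith

end Limits

section Line

theorem iteratedDeriv_comp_line {E G : Type*} [NormedAddCommGroup E] [NormedSpace ℝ E]
    [NormedAddCommGroup G] [NormedSpace ℝ G] {U : Set E} (hU : IsOpen U) {f : E → G}
    (hf : ContDiffOn ℝ (⊤ : ℕ∞) f U) {x : E} (hx : x ∈ U) (v : E) (k : ℕ) :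
    iteratedDeriv k (fun t : ℝ => f (x + t • v)) 0 = iteratedFDeriv ℝ k f x fun _ => v := by
  set L : ℝ →L[ℝ] E := ContinuousLinearMap.toSpanSingleton ℝ v with hL
  set U' : Set E := (fun y => x + y) ⁻¹' U with hU'
  have hU'o : IsOpen U' := hU.preimage (by fun_prop)
  have hf' : ContDiffOn ℝ (⊤ : ℕ∞) (fun y => f (x + y)) U' :=
    hf.comp (by fun_prop) (mapsTo_preimage _ _)
  have h0 : L 0 ∈ U' := by simpa [hU'] using hx
  have hpo : IsOpen (L ⁻¹' U') := hU'o.preimage L.continuous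
  have h := L.iteratedFDerivWithin_comp_right hf' hU'o.uniqueDiffOn hpo.uniqueDiffOn h0
    (i := k) (by exact_mod_cast le_top)
  rw [iteratedFDerivWithin_of_isOpen k hpo h0, iteratedFDerivWithin_of_isOpen k hU'o h0,
    iteratedFDeriv_comp_add_left] at h
  have e : (fun t : ℝ => f (x + t • v)) = (fun y => f (x + y)) ∘ L := by
    funext t; simp [hL]
  rw [e, iteratedDeriv_eq_iteratedFDeriv, h]
  simp [hL]

end Line

section Weights

theorem exists_pos_of_mg_lt_top {M N : ℕ → ℝ} (hM : ∀ k, 0 < M k) (hN : ∀ k, 0 < N k)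
    (h : mg M N < ⊤) :
    ∃ D : ℝ, 0 < D ∧ ∀ j k : ℕ, 1 ≤ j + k → M (j + k) ≤ D ^ (j + k) * (N j * N k) := by
  refine ⟨(mg M N).toReal + 1, by positivity, fun j k hjk => ?_⟩
  have h1 : ENNReal.ofReal ((M (j + k) / (N j * N k)) ^ (((j : ℝ) + (k : ℝ))⁻¹)) ≤ mg M N :=
    le_iSup_of_le j (le_iSup_of_le k (le_iSup_of_le hjk le_rfl))
  have hq : 0 < M (j + k) / (N j * N k) := div_pos (hM _) (mul_pos (hN _) (hN _))
  have h2 : (M (j + k) / (N j * N k)) ^ (((j : ℝ) + (k : ℝ))⁻¹) ≤ (mg M N).toReal + 1 :=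
    ((ENNReal.ofReal_le_iff_le_toReal h.ne).1 h1).trans (by linarith)
  have h3 := pow_le_pow_left₀ (by positivity) h2 (j + k)
  rw [← Nat.cast_add, Real.rpow_inv_natCast_pow hq.le (by omega),
    div_le_iff₀ (mul_pos (hN _) (hN _))] at h3
  exact h3

theorem exists_factorial_le {N : ℕ → ℝ} (hN : ∀ k, 0 < N k) (hr : RootsTendsto (lc N)) :
    ∃ C : ℝ, 0 < C ∧ ∀ k : ℕ, (k.factorial : ℝ) ≤ C * N k := by
  have hev : ∀ᶠ k : ℕ in atTop, (k.factorial : ℝ) / N k ≤ 1 := by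
    filter_upwards [hr.eventually_ge_atTop 1, eventually_gt_atTop 0] with k hk hk0
    have hpos : 0 < lc N k := div_pos (hN k) (by positivity)
    have h1 := one_le_pow₀ (n := k) hk
    rw [one_div, Real.rpow_inv_natCast_pow hpos.le (by omega), lc,
      le_div_iff₀ (by positivity), one_mul] at h1
    rwa [div_le_one (hN k)]
  obtain ⟨C, hC⟩ := (IsBoundedUnder.bddAbove_range ⟨1, by simpa using hev⟩ :
    BddAbove (range fun k : ℕ => (k.factorial : ℝ) / N k))
  have hC' : ∀ k : ℕ, (k.factorial : ℝ) ≤ C * N k := fun k =>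
    (div_le_iff₀ (hN k)).1 (hC ⟨k, rfl⟩)
  refine ⟨C, ?_, hC'⟩
  have := hC' 0
  have h0 := hN 0
  by_contra hle
  push Not at hle
  simp only [Nat.factorial_zero, Nat.cast_one] at this
  nlinarith

theorem hfn_le {m : ℕ → ℝ} (hm : ∀ k, 0 < m k) {t : ℝ} (ht : 0 < t) (k : ℕ) :
    hfn m t ≤ m k * t ^ k := by
  rw [hfn, if_neg ht.not_ge]
  exact ciInf_le ⟨0, by rintro _ ⟨i, rfl⟩; have := hm i; positivity⟩ k

/-- Two steps of the moderate growth comparison between the three sequences. -/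
theorem sqrt_lc_le {N1 N2 N3 : ℕ → ℝ} {D1 D2 : ℝ} (hD1 : 0 < D1) (hD2 : 0 < D2)
    (hN2 : ∀ k, 0 < N2 k) (hN3 : ∀ k, 0 < N3 k)
    (h1 : ∀ j k : ℕ, 1 ≤ j + k → N1 (j + k) ≤ D1 ^ (j + k) * (N2 j * N2 k))
    (h2 : ∀ j k : ℕ, 1 ≤ j + k → N2 (j + k) ≤ D2 ^ (j + k) * (N3 j * N3 k)) (k : ℕ) :
    √(lc N1 (k + 1 + (k + 1))) ≤ (D1 * D2) ^ (k + 1) * (N3 k * N3 1) / k.factorial := by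
  have hle : lc N1 (k + 1 + (k + 1)) ≤ (D1 ^ (k + 1) * N2 (k + 1) / (k + 1).factorial) ^ 2 := by
    have hfac : (((k + 1).factorial * (k + 1).factorial : ℕ) : ℝ)
        ≤ ((k + 1 + (k + 1)).factorial : ℕ) := by
      exact_mod_cast Nat.le_of_dvd (Nat.factorial_pos _)
        (Nat.factorial_mul_factorial_dvd_factorial_add _ _)
    push_cast at hfac
    have := hN2 (k + 1)
    calc lc N1 (k + 1 + (k + 1))
        ≤ D1 ^ (k + 1 + (k + 1)) * (N2 (k + 1) * N2 (k + 1)) / (k + 1 + (k + 1)).factorial := by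
          rw [lc]; gcongr; exact h1 _ _ (by omega)
      _ ≤ D1 ^ (k + 1 + (k + 1)) * (N2 (k + 1) * N2 (k + 1))
            / ((k + 1).factorial * (k + 1).factorial) := by
          gcongr
      _ = _ := by rw [pow_add, div_pow]; ring
  have hN2' := hN2 (k + 1)
  have hN3k := hN3 k
  have hN31 := hN3 1
  refine (Real.sqrt_le_sqrt hle).trans ?_
  rw [Real.sqrt_sq (by positivity)]
  have hfac : (k.factorial : ℝ) ≤ (k + 1).factorial := by
    exact_mod_cast Nat.factorial_le (Nat.le_succ k)
  calc D1 ^ (k + 1) * N2 (k + 1) / (k + 1).factorial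
      ≤ D1 ^ (k + 1) * (D2 ^ (k + 1) * (N3 k * N3 1)) / k.factorial := by
        gcongr; exact h2 k 1 (by omega)
    _ = _ := by rw [mul_pow]; ring

end Weights

section Ellipse

theorem isOpen_Omega (ε : ℝ) : IsOpen (Omega ε) :=
  isOpen_lt (by fun_prop) continuous_const

theorem closedBall_subset_Omega {ε t : ℝ} (hε : 0 < ε) (hε' : ε ≤ 1 / 2) (ht : |t| ≤ 1 / 2) :
    closedBall (t : ℂ) (ε / 2) ⊆ Omega ε := by
  intro z hz
  rw [mem_closedBall_iff_norm] at hz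
  have hre : |z.re| ≤ 3 / 4 := by
    have h1 := (Complex.abs_re_le_norm (z - t)).trans hz
    simp only [Complex.sub_re, Complex.ofReal_re] at h1
    have h2 := abs_sub_abs_le_abs_sub z.re t
    linarith
  have him : |z.im| ≤ ε / 2 := by
    simpa using (Complex.abs_im_le_norm (z - t)).trans hz
  have hc : 1 ≤ Real.cosh ε := Real.one_le_cosh ε
  have hs : ε ≤ Real.sinh ε := Real.self_le_sinh_iff.2 hε.le
  have h1 : |z.re / Real.cosh ε| ≤ 3 / 4 := by
    rw [abs_div, abs_of_pos (by linarith : 0 < Real.cosh ε), div_le_iff₀ (by linarith)]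
    nlinarith
  have h2 : |z.im / Real.sinh ε| ≤ 1 / 2 := by
    rw [abs_div, abs_of_pos (by linarith : 0 < Real.sinh ε), div_le_iff₀ (by linarith)]
    nlinarith
  have h3 := sq_le_sq' (abs_le.1 h1).1 (abs_le.1 h1).2
  have h4 := sq_le_sq' (abs_le.1 h2).1 (abs_le.1 h2).2
  show (z.re / Real.cosh ε) ^ 2 + (z.im / Real.sinh ε) ^ 2 < 1
  linarith

end Ellipse

/-- Derivative bounds of a function of one variable admitting bounded holomorphic approximations
on the ellipses `Omega ε` with error `q * ε ^ (2 * (k + 1))` on `[-1, 1]`. -/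
theorem norm_iteratedDeriv_le_of_approx {g : ℝ → ℂ} {F : ℝ → ℂ → ℂ} {K q ε0 : ℝ} (hK : 1 ≤ K)
    (hq : 0 < q) (hε0 : 0 < ε0) (hε0' : ε0 ≤ 1 / 2) (k : ℕ)
    (hF : ∀ ε : ℝ, 0 < ε → ε ≤ ε0 → DifferentiableOn ℂ (F ε) (Omega ε) ∧
      (∀ z ∈ Omega ε, ‖F ε z‖ ≤ K) ∧
      ∀ t ∈ Icc (-1 : ℝ) 1, ‖g t - F ε t‖ ≤ q * ε ^ (2 * (k + 1))) :
    ‖iteratedDeriv k g 0‖ ≤ k.factorial * K / (ε0 / 2) ^ k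
      + 2 * (k.factorial * (2 * √(K * q)) * 20 ^ k) := by
  set e : ℕ → ℝ := fun j => ε0 * (1 / 2) ^ j with he
  have hepos : ∀ j, 0 < e j := fun j => by positivity
  have hele : ∀ j, e j ≤ ε0 := fun j =>
    mul_le_of_le_one_right hε0.le (pow_le_one₀ (by norm_num) (by norm_num))
  have hesucc : ∀ j, e (j + 1) = e j / 2 := fun j => by simp only [he, pow_succ]; ring
  have hhalf : ∀ j, e j ≤ (1 / 2) ^ j := fun j =>
    mul_le_of_le_one_left (by positivity) (by linarith)
  have hFj := fun j => hF (e j) (hepos j) (hele j)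
  set s : Set ℝ := Ioo (-(1 / 2)) (1 / 2) with hs
  have hsabs : ∀ t ∈ s, |t| ≤ 1 / 2 := fun t ht => abs_le.2 ⟨ht.1.le, ht.2.le⟩
  have hball : ∀ j, ∀ t ∈ s, closedBall (t : ℂ) (e j / 2) ⊆ Omega (e j) := fun j t ht =>
    closedBall_subset_Omega (hepos j) ((hele j).trans hε0') (hsabs t ht)
  have hmem : ∀ j, ∀ t ∈ s, (t : ℂ) ∈ Omega (e j) := fun j t ht =>
    hball j t ht (mem_closedBall_self (by have := hepos j; positivity))
  have han : ∀ j, ∀ t ∈ s, AnalyticAt ℂ (F (e j)) t := fun j t ht =>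
    (hFj j).1.analyticAt ((isOpen_Omega _).mem_nhds (hmem j t ht))
  have h := norm_iteratedDeriv_le_of_geometric (s := s) isOpen_Ioo (g := g)
    (φ := fun i j t => iteratedDeriv i (F (e j)) t) (k := k)
    (C := fun i => i.factorial * (2 * √(K * q)) * 20 ^ i) ?_ ?_ ?_ (t := 0)
    (by rw [hs]; constructor <;> norm_num)
  · refine h.trans (add_le_add_left ?_ _)
    have hR : 0 < ε0 / 2 := by positivity
    have h0 : e 0 = ε0 := by simp [he]
    have hs0 : (0 : ℝ) ∈ s := by rw [hs]; constructor <;> norm_num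
    have hb := hball 0 0 hs0
    rw [h0] at hb
    have hF0 := hFj 0
    rw [h0] at hF0
    rw [h0]
    refine Complex.norm_iteratedDeriv_le_of_forall_mem_sphere_norm_le k hR
      (DifferentiableOn.diffContOnCl (hF0.1.mono ?_)) fun z hz =>
        hF0.2.1 z (hb (sphere_subset_closedBall hz))
    rwa [closure_ball _ hR.ne']
  · intro i j t ht
    have h1 : HasDerivAt (iteratedDeriv i (F (e j))) (iteratedDeriv (i + 1) (F (e j)) t) t := by
      rw [iteratedDeriv_succ]
      exact ((han j t ht).iterated_deriv i |>.differentiableAt |> fun h => by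
        simpa [iteratedDeriv_eq_iterate] using h.hasDerivAt)
    exact h1.comp_ofReal
  · intro i hi j t ht
    have hej := hepos j
    have hej1 := hepos (j + 1)
    set G : ℂ → ℂ := F (e j) - F (e (j + 1)) with hG
    set R := e j / 4 with hR
    have hRpos : 0 < R := by positivity
    have hRe : R = e (j + 1) / 2 := by rw [hesucc, hR]; ring
    have hb1 : closedBall (t : ℂ) R ⊆ Omega (e j) :=
      (closedBall_subset_closedBall (by rw [hR]; linarith)).trans (hball j t ht)
    have hb2 : closedBall (t : ℂ) R ⊆ Omega (e (j + 1)) := hRe ▸ hball (j + 1) t ht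
    have hdiff : DifferentiableOn ℂ G (closedBall (t : ℂ) R) :=
      ((hFj j).1.mono hb1).sub ((hFj (j + 1)).1.mono hb2)
    have hsub : iteratedDeriv i (F (e j)) t - iteratedDeriv i (F (e (j + 1))) t
        = iteratedDeriv i G t :=
      (iteratedDeriv_sub (han j t ht).contDiffAt (han (j + 1) t ht).contDiffAt).symm
    have hbound := norm_iteratedDeriv_le_sqrt (G := G) (M := 2 * K)
      (δ := 2 * (q * e j ^ (2 * (k + 1)))) (by positivity) hRpos
      (hdiff.mono ball_subset_closedBall) hdiff.continuousOn
      (fun z hz => by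
        have h1 := (hFj j).2.1 z (hb1 hz)
        have h2 := (hFj (j + 1)).2.1 z (hb2 hz)
        exact (norm_sub_le _ _).trans (by linarith))
      (fun u hu => by
        have hu' : u ∈ Icc (-1 : ℝ) 1 := by
          have h1 := abs_sub_abs_le_abs_sub u t
          have h2 := hsabs t ht
          have h3 := hele j
          exact abs_le.1 (by rw [hR] at hu; linarith)
        have h1 := (hFj j).2.2 u hu'
        have h2 := (hFj (j + 1)).2.2 u hu'
        have h3 : q * e (j + 1) ^ (2 * (k + 1)) ≤ q * e j ^ (2 * (k + 1)) := by
          gcongr; rw [hesucc]; linarith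
        have h4 : G u = (g u - F (e (j + 1)) u) - (g u - F (e j) u) := by
          simp [hG]
        rw [h4]
        exact (norm_sub_le _ _).trans (by linarith)) i
    rw [dist_eq_norm, hsub]
    refine hbound.trans ?_
    have hsqrt : √(2 * K * (2 * (q * e j ^ (2 * (k + 1))))) = 2 * √(K * q) * e j ^ (k + 1) := by
      have : 2 * K * (2 * (q * e j ^ (2 * (k + 1)))) = (2 * e j ^ (k + 1)) ^ 2 * (K * q) := by
        rw [mul_pow, ← pow_mul, mul_comm 2 (k + 1)]; ring
      rw [this, Real.sqrt_mul (by positivity), Real.sqrt_sq (by positivity)]; ring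
    have hpow : e j ^ (k + 1) ≤ e j ^ i * (1 / 2) ^ j := by
      obtain ⟨r, rfl⟩ := Nat.exists_eq_add_of_le hi
      have h1 : e j ^ (r + 1) ≤ e j := by
        rw [pow_succ]
        exact mul_le_of_le_one_left hej.le (pow_le_one₀ hej.le (by linarith [hele j]))
      calc e j ^ (i + r + 1) = e j ^ i * e j ^ (r + 1) := by rw [add_assoc, pow_add]
        _ ≤ _ := by gcongr; exact h1.trans (hhalf j)
    rw [hsqrt, div_le_iff₀ (by positivity)]
    calc (i.factorial : ℝ) * (2 * √(K * q) * e j ^ (k + 1))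
        ≤ i.factorial * (2 * √(K * q) * (e j ^ i * (1 / 2) ^ j)) := by gcongr
      _ = i.factorial * (2 * √(K * q)) * 20 ^ i * (1 / 2) ^ j * (R / 5) ^ i := by
        have : e j = 20 * (R / 5) := by rw [hR]; ring
        rw [this, mul_pow]; ring
  · intro t ht
    have ht' : t ∈ Icc (-1 : ℝ) 1 := ⟨by linarith [ht.1], by linarith [ht.2]⟩
    rw [tendsto_iff_norm_sub_tendsto_zero]
    have he0 : Tendsto e atTop (𝓝 0) := by
      simpa [he] using (tendsto_pow_atTop_nhds_zero_of_lt_one (by norm_num : (0 : ℝ) ≤ 1 / 2)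
        (by norm_num)).const_mul ε0
    have hlim : Tendsto (fun j => q * e j ^ (2 * (k + 1))) atTop (𝓝 0) := by
      simpa using (he0.pow (2 * (k + 1))).const_mul q
    refine squeeze_zero (fun _ => norm_nonneg _) (fun j => ?_) hlim
    simpa [norm_sub_rev] using (hFj j).2.2 t ht'

/-- Directional derivatives along unit vectors inherit the one-variable bound. -/
theorem norm_iteratedFDeriv_diagonal_le {E : Type*} [NormedAddCommGroup E] [NormedSpace ℝ E]
    {U : Set E} (hU : IsOpen U) {f : E → ℂ} (hf : ContDiffOn ℝ (⊤ : ℕ∞) f U) {x : E}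
    (hx : x ∈ U) {k : ℕ} {B : ℝ}
    (hB : ∀ v : E, ‖v‖ = 1 → ‖iteratedDeriv k (fun t : ℝ => f (x + t • v)) 0‖ ≤ B)
    (h0 : k = 0 → Subsingleton E → ‖f x‖ ≤ B) (hB0 : 0 ≤ B) (v : E) :
    ‖iteratedFDeriv ℝ k f x fun _ => v‖ ≤ B * ‖v‖ ^ k := by
  have hunit : ∀ v : E, ‖v‖ = 1 → ‖iteratedFDeriv ℝ k f x fun _ => v‖ ≤ B := fun v hv => by
    rw [← iteratedDeriv_comp_line hU hf hx v k]; exact hB v hv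
  rcases eq_or_ne v 0 with rfl | hv
  · cases k with
    | zero =>
      rw [iteratedFDeriv_zero_apply, pow_zero, mul_one]
      rcases subsingleton_or_nontrivial E with hE | hE
      · exact h0 rfl hE
      · obtain ⟨u, hu⟩ := exists_norm_eq E zero_le_one
        simpa using hunit u hu
    | succ k =>
      rw [(iteratedFDeriv ℝ (k + 1) f x).map_coord_zero 0 rfl, norm_zero]
      positivity
  · have hn : ‖v‖ ≠ 0 := norm_ne_zero_iff.2 hv
    have h1 := hunit (‖v‖⁻¹ • v) (by rw [norm_smul, norm_inv, norm_norm, inv_mul_cancel₀ hn])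
    have h2 := (iteratedFDeriv ℝ k f x).map_smul_univ (fun _ => ‖v‖) (fun _ => ‖v‖⁻¹ • v)
    simp only [smul_smul, mul_inv_cancel₀ hn, one_smul, Finset.prod_const, Finset.card_univ,
      Fintype.card_fin] at h2
    rw [h2, norm_smul, norm_pow, norm_norm, mul_comm]
    gcongr

/-- Uniform unidirectional holomorphic approximation, part (ii). -/
theorem statement10 {d : ℕ} (U : Set (EuclideanSpace ℝ (Fin d))) (hU : IsOpen U)
    (f : EuclideanSpace ℝ (Fin d) → ℂ)
    (hf : ContDiffOn ℝ (⊤ : ℕ∞) f (VU U))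
    (N1 N2 N3 : ℕ → ℝ) (hN1 : IsWeightSeq N1) (hN2 : IsWeightSeq N2) (hN3 : IsWeightSeq N3)
    (hr1 : RootsTendsto (lc N1)) (hr2 : RootsTendsto (lc N2)) (hr3 : RootsTendsto (lc N3))
    (hD1 : mg N1 N2 < ⊤) (hD2 : mg N2 N3 < ⊤)
    (K : ℝ) (hK : 1 ≤ K) (c1 : ℝ) (hc1 : 0 < c1) (c2 : ℝ) (hc2 : 0 < c2)
    (ε0 : ℝ) (hε0 : 0 < ε0) (hε0' : ε0 ≤ 1 / 2)
    (F : EuclideanSpace ℝ (Fin d) → EuclideanSpace ℝ (Fin d) → ℝ → ℂ → ℂ)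
    (hF : ∀ x ∈ U, ∀ v : EuclideanSpace ℝ (Fin d), ‖v‖ = 1 →
      ∀ ε : ℝ, 0 < ε → ε ≤ 2 * ε0 →
        DifferentiableOn ℂ (F x v ε) (Omega ε) ∧
        ContinuousOn (F x v ε) (closure (Omega ε)) ∧
        (∀ z ∈ Omega ε, ‖F x v ε z‖ ≤ K) ∧
        (∀ t ∈ Icc (-1 : ℝ) 1,
          ‖f (x + t • v) - F x v ε (t : ℂ)‖ ≤ c1 * hfn (lc N1) (c2 * ε))) :
    ∃ σ : ℝ, 0 < σ ∧ GlobalClass N3 σ f U := by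
  have hUV : U ⊆ VU U := fun x hx => mem_biUnion hx (mem_closedBall_self zero_le_one)
  have hfU : ContDiffOn ℝ (⊤ : ℕ∞) f U := hf.mono hUV
  obtain ⟨D1, hD1pos, hD1le⟩ := exists_pos_of_mg_lt_top hN1.pos hN2.pos hD1
  obtain ⟨D2, hD2pos, hD2le⟩ := exists_pos_of_mg_lt_top hN2.pos hN3.pos hD2
  obtain ⟨C0, hC0, hfac⟩ := exists_factorial_le hN3.pos hr3
  have hlc : ∀ k, 0 < lc N1 k := fun k => div_pos (hN1.pos k) (by positivity)
  have hK0 : 0 < K := by linarith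
  have hN31 := hN3.pos 1
  set ρ := 2 / ε0 + 20 * (c2 * (D1 * D2)) with hρ
  have hρ0 : 0 < ρ := by positivity
  set A := C0 * K + 4 * √(K * c1) * (c2 * (D1 * D2)) * N3 1 with hA
  have hA0 : 0 < A := by positivity
  refine ⟨Real.exp 1 * ρ, by positivity, hfU, A + ‖f 0‖, fun x hx k => ?_⟩
  have hN3k := hN3.pos k
  have hline : ∀ v : EuclideanSpace ℝ (Fin d), ‖v‖ = 1 →
      ‖iteratedDeriv k (fun t : ℝ => f (x + t • v)) 0‖ ≤ A * ρ ^ k * N3 k := by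
    intro v hv
    set q := c1 * (lc N1 (k + 1 + (k + 1)) * c2 ^ (k + 1 + (k + 1))) with hq
    have hq0 : 0 < q := by have := hlc (k + 1 + (k + 1)); positivity
    have h := norm_iteratedDeriv_le_of_approx (g := fun t : ℝ => f (x + t • v)) (F := F x v)
      hK hq0 hε0 hε0' k fun ε hε hεle => by
        obtain ⟨h1, -, h3, h4⟩ := hF x hx v hv ε hε (by linarith)
        refine ⟨h1, h3, fun t ht => (h4 t ht).trans ?_⟩
        have h5 := mul_le_mul_of_nonneg_left
          (hfn_le hlc (mul_pos hc2 hε) (k + 1 + (k + 1))) hc1.le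
        refine h5.trans_eq ?_
        rw [hq, mul_pow, two_mul]; ring
    have hsq : √(K * q) ≤ √(K * c1) * c2 ^ (k + 1) *
        ((D1 * D2) ^ (k + 1) * (N3 k * N3 1) / k.factorial) := by
      have e : K * q = K * c1 * (c2 ^ (k + 1)) ^ 2 * lc N1 (k + 1 + (k + 1)) := by
        rw [hq, pow_add]; ring
      rw [e, Real.sqrt_mul (by positivity), Real.sqrt_mul (by positivity),
        Real.sqrt_sq (by positivity)]
      gcongr
      exact sqrt_lc_le hD1pos hD2pos hN2.pos hN3.pos hD1le hD2le k
    have hterm1 : k.factorial * K / (ε0 / 2) ^ k ≤ C0 * K * ρ ^ k * N3 k := by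
      have e : k.factorial * K / (ε0 / 2) ^ k = k.factorial * K * (2 / ε0) ^ k := by
        rw [div_eq_mul_inv, ← inv_pow, inv_div]
      rw [e]
      calc k.factorial * K * (2 / ε0) ^ k ≤ C0 * N3 k * K * ρ ^ k := by
            gcongr
            · exact hfac k
            · rw [hρ]; exact le_add_of_nonneg_right (by positivity)
        _ = _ := by ring
    have hterm2 : 2 * (k.factorial * (2 * √(K * q)) * 20 ^ k)
        ≤ 4 * √(K * c1) * (c2 * (D1 * D2)) * N3 1 * ρ ^ k * N3 k := by
      calc 2 * (k.factorial * (2 * √(K * q)) * 20 ^ k)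
          ≤ 2 * (k.factorial * (2 * (√(K * c1) * c2 ^ (k + 1) *
            ((D1 * D2) ^ (k + 1) * (N3 k * N3 1) / k.factorial))) * 20 ^ k) := by gcongr
        _ = 4 * √(K * c1) * (c2 * (D1 * D2)) * N3 1 * (20 * (c2 * (D1 * D2))) ^ k * N3 k := by
            have : (k.factorial : ℝ) ≠ 0 := by positivity
            field_simp
            ring
        _ ≤ _ := by
            gcongr
            rw [hρ]; exact le_add_of_nonneg_left (by positivity)
    calc _ ≤ _ := h
      _ ≤ _ := add_le_add hterm1 hterm2
      _ = A * ρ ^ k * N3 k := by rw [hA]; ring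
  set B := (A + ‖f 0‖) * ρ ^ k * N3 k with hB
  have hB0 : 0 ≤ B := by positivity
  rw [iteratedFDerivWithin_of_isOpen k hU hx]
  have hdiag : ∀ v, ‖iteratedFDeriv ℝ k f x fun _ => v‖ ≤ B * ‖v‖ ^ k := by
    refine norm_iteratedFDeriv_diagonal_le hU hfU hx (fun v hv => (hline v hv).trans ?_)
      (fun hk hE => ?_) hB0
    · rw [hB]; gcongr; exact le_add_of_nonneg_right (norm_nonneg _)
    · subst hk
      rw [hB, hN3.first, Subsingleton.elim x 0]
      simpa using hA0.le
  have hfin := norm_le_exp_mul_of_diagonal (iteratedFDeriv ℝ k f x)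
    (fun σ v => iteratedFDeriv_comp_perm_of_contDiffOn hU hfU hx σ v) hB0 fun v _ => hdiag v
  refine hfin.trans_eq ?_
  rw [hB, mul_pow]; ring

end JorisPaper
end
end

section
/- Let E be a Banach space, U ⊆ E open, 𝔐 a weight matrix, and f : U → ℂ smooth. Then f belongs to the Beurling class E^{(𝔐)}(U) if and only if for every a ∈ U, every M ∈ 𝔐 and every ρ > 0 there exists r > 0 such that f restricted to the open ball B(a,r) belongs to B^M_ρ(B(a,r)). -/
open Set Filter Topology Metric
open scoped ENNReal NNReal Topology

noncomputable section

namespace JorisPaper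

section SeqBoundedOn

variable {E F : Type*} [NormedAddCommGroup E] [NormedSpace ℝ E]
  [NormedAddCommGroup F] [NormedSpace ℝ F] {M : ℕ → ℝ} {ρ : ℝ} {f : E → F} {U V K L : Set E}

theorem SeqBoundedOn.mono (h : SeqBoundedOn M ρ f U L) (hKL : K ⊆ L) : SeqBoundedOn M ρ f U K :=
  h.imp fun _ hC x hx => hC x (hKL hx)

theorem SeqBoundedOn.union (hM : ∀ k, 0 ≤ M k) (hρ : 0 ≤ ρ) (hK : SeqBoundedOn M ρ f U K)
    (hL : SeqBoundedOn M ρ f U L) : SeqBoundedOn M ρ f U (K ∪ L) := by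
  obtain ⟨C, hC⟩ := hK
  obtain ⟨D, hD⟩ := hL
  refine ⟨max C D, fun x hx k => ?_⟩
  have hMk := hM k
  rcases hx with hx | hx
  · exact (hC x hx k).trans (by gcongr; exact le_max_left C D)
  · exact (hD x hx k).trans (by gcongr; exact le_max_right C D)

/-- On open sets the choice of the set within which derivatives are taken is irrelevant. -/
theorem seqBoundedOn_congr_isOpen (hU : IsOpen U) (hV : IsOpen V) (hKU : K ⊆ U) (hKV : K ⊆ V) :
    SeqBoundedOn M ρ f U K ↔ SeqBoundedOn M ρ f V K := by
  refine exists_congr fun C => forall₂_congr fun x hx => forall_congr' fun k => ?_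
  rw [iteratedFDerivWithin_of_isOpen k hU (hKU hx), iteratedFDerivWithin_of_isOpen k hV (hKV hx)]

theorem seqBoundedOn_of_isCompact (hM : ∀ k, 0 ≤ M k) (hρ : 0 ≤ ρ) (hK : IsCompact K)
    (h : ∀ a ∈ K, ∃ V ∈ 𝓝 a, SeqBoundedOn M ρ f U V) : SeqBoundedOn M ρ f U K := by
  refine hK.induction_on ⟨0, fun x hx => hx.elim⟩ (fun s t hst ht => ht.mono hst)
    (fun s t hs ht => hs.union hM hρ ht) fun a ha => ?_
  obtain ⟨V, hV, hb⟩ := h a ha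
  exact ⟨V, mem_nhdsWithin_of_mem_nhds hV, hb⟩

/-- Boundedness on every compact subset of `U` forces boundedness on some ball around each point:
otherwise a sequence of violating points converges to the centre. -/
theorem exists_seqBoundedOn_ball (hM : ∀ k, 0 ≤ M k) (hρ : 0 ≤ ρ) (hU : IsOpen U)
    (h : ∀ K ⊆ U, IsCompact K → SeqBoundedOn M ρ f U K) {a : E} (ha : a ∈ U) :
    ∃ r : ℝ, 0 < r ∧ ball a r ⊆ U ∧ SeqBoundedOn M ρ f U (ball a r) := by
  obtain ⟨δ, hδ, hδU⟩ := Metric.isOpen_iff.1 hU a ha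
  have hpos : ∀ n : ℕ, 0 < δ / ((n : ℝ) + 1) := fun n => by positivity
  have hsub : ∀ n : ℕ, ball a (δ / ((n : ℝ) + 1)) ⊆ U := fun n =>
    (ball_subset_ball (div_le_self hδ.le (by simp))).trans hδU
  by_contra! hcon
  have hbad : ∀ n : ℕ, ∃ x ∈ ball a (δ / ((n : ℝ) + 1)), ∃ k : ℕ,
      (n : ℝ) * ρ ^ k * M k < ‖iteratedFDerivWithin ℝ k f U x‖ := fun n => by
    have := hcon _ (hpos n) (hsub n)
    contrapose! this
    exact ⟨n, this⟩
  choose x hx k hk using hbad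
  have hlim : Tendsto x atTop (𝓝 a) := by
    rw [tendsto_iff_dist_tendsto_zero]
    exact squeeze_zero (fun _ => dist_nonneg) (fun n => (mem_ball.1 (hx n)).le)
      (by simpa [div_eq_mul_inv] using tendsto_one_div_add_atTop_nhds_zero_nat.const_mul δ)
  obtain ⟨C, hC⟩ := h (insert a (range x))
    (insert_subset ha (range_subset_iff.2 fun n => hsub n (hx n))) hlim.isCompact_insert_range
  obtain ⟨n, hn⟩ := exists_nat_ge C
  have hMk := hM (k n)
  refine (hk n).not_ge ((hC (x n) (mem_insert_of_mem _ (mem_range_self n)) (k n)).trans ?_)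
  gcongr

end SeqBoundedOn

/-- Localization of the Beurling class on a Banach space. -/
theorem statement13 {E : Type*} [NormedAddCommGroup E] [NormedSpace ℝ E] [CompleteSpace E]
    (U : Set E) (hU : IsOpen U) (W : Set (ℕ → ℝ)) (hW : IsWeightMatrix W)
    (f : E → ℂ) (hf : ContDiffOn ℝ (⊤ : ℕ∞) f U) :
    Beurling W U f ↔
      ∀ a ∈ U, ∀ M ∈ W, ∀ ρ : ℝ, 0 < ρ → ∃ r : ℝ, 0 < r ∧
        Metric.ball a r ⊆ U ∧ GlobalClass M ρ f (Metric.ball a r) := by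
  constructor
  · intro h a ha M hM ρ hρ
    obtain ⟨r, hr, hrU, hb⟩ := exists_seqBoundedOn_ball (fun k => ((hW.weight M hM).pos k).le)
      hρ.le hU (fun K hKU hK => h.2 K hKU hK M hM ρ hρ) ha
    exact ⟨r, hr, hrU, hf.mono hrU, (seqBoundedOn_congr_isOpen hU isOpen_ball hrU Subset.rfl).1 hb⟩
  · intro h
    refine ⟨hf, fun K hKU hK M hM ρ hρ => seqBoundedOn_of_isCompact
      (fun k => ((hW.weight M hM).pos k).le) hρ.le hK fun a ha => ?_⟩
    obtain ⟨r, hr, hrU, -, hb⟩ := h a (hKU ha) M hM ρ hρ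
    exact ⟨ball a r, ball_mem_nhds a hr,
      (seqBoundedOn_congr_isOpen hU isOpen_ball hrU Subset.rfl).2 hb⟩

end JorisPaper
end
end
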